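/- arXiv:2403.02933 — 3 statements merged into one kernel-verified Lean document; each statement's English description precedes it below -/
import Mathlib

section
/- Existence and uniqueness of the minimal (universal) fuzzy model: let A be an arbitrary type of ground atoms, Π a set of ground rules over A, and D : A → [0,1] a fuzzy dataset. Then the set of models of (Π, D) is nonempty (the constantly-1 interpretation is a model), the pointwise infimum I*(X) = inf { I'(X) : I' a model of (Π, D) } is itself a model of (Π, D), and I* is the unique model of (Π, D) satisfying I* ≤ I' pointwise for every model I' of (Π, D). -/
instance : Fact ((0:ℝ) ≤ 1) := ⟨zero_le_one⟩

/-- A t-norm: a commutative, associative, monotone binary operation on the real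
unit interval with 1 as identity element. -/
structure Tnorm where
  toFun : unitInterval → unitInterval → unitInterval
  comm : ∀ a b, toFun a b = toFun b a
  assoc : ∀ a b c, toFun (toFun a b) c = toFun a (toFun b c)
  mono : ∀ a a' b, a ≤ a' → toFun a b ≤ toFun a' b
  one_identity : ∀ a, toFun a 1 = a

/-- A ground rule over a type `A` of ground atoms: a t-norm, a nonempty finite
list of body atoms, and a head atom. -/
structure Rule (A : Type*) where
  tnorm : Tnorm
  body : List A
  body_ne : body ≠ []
  head : A

/-- The body fold of a rule under a fuzzy interpretation `I : A → [0,1]`: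
the iterated t-norm of the values of `I` on the body atoms. -/
def Rule.bodyFold {A : Type*} (r : Rule A) (I : A → unitInterval) : unitInterval :=
  (r.body.map I).foldr r.tnorm.toFun 1

/-- `I` satisfies rule `r` (1-satisfaction under Łukasiewicz implication). -/
def Rule.Sat {A : Type*} (r : Rule A) (I : A → unitInterval) : Prop :=
  r.bodyFold I ≤ I r.head

/-- `I` is a fuzzy model of the program `P` and the fuzzy dataset `D`. -/
def IsModel {A : Type*} (P : Set (Rule A)) (D : A → unitInterval)
    (I : A → unitInterval) : Prop :=
  (∀ r ∈ P, r.Sat I) ∧ ∀ X, D X ≤ I X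

theorem Tnorm.toFun_le_toFun (t : Tnorm) {a a' b b' : unitInterval} (ha : a ≤ a') (hb : b ≤ b') :
    t.toFun a b ≤ t.toFun a' b' := by
  refine (t.mono a a' b ha).trans ?_
  rw [t.comm a' b, t.comm a' b']
  exact t.mono b b' a' hb

theorem Rule.bodyFold_mono {A : Type*} (r : Rule A) {I J : A → unitInterval}
    (h : ∀ X, I X ≤ J X) : r.bodyFold I ≤ r.bodyFold J := by
  unfold Rule.bodyFold
  induction r.body with
  | nil => exact le_rfl
  | cons X l ih => exact r.tnorm.toFun_le_toFun (h X) ih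

theorem isModel_one {A : Type*} (P : Set (Rule A)) (D : A → unitInterval) :
    IsModel P D (fun _ => 1) :=
  ⟨fun _ _ => unitInterval.le_one', fun _ => unitInterval.le_one'⟩

theorem iInf_isModel_le {A : Type*} {P : Set (Rule A)} {D I : A → unitInterval}
    (hI : IsModel P D I) (X : A) : (⨅ I' : {J // IsModel P D J}, I'.1 X) ≤ I X :=
  iInf_le (fun I' : {J // IsModel P D J} => I'.1 X) ⟨I, hI⟩

theorem isModel_iInf {A : Type*} (P : Set (Rule A)) (D : A → unitInterval) :
    IsModel P D (fun X => ⨅ I' : {J // IsModel P D J}, I'.1 X) :=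
  ⟨fun r hr => le_iInf fun I' =>
      (r.bodyFold_mono (iInf_isModel_le I'.2)).trans (I'.2.1 r hr),
    fun X => le_iInf fun I' => I'.2.2 X⟩

/-- Existence and uniqueness of the minimal (universal) fuzzy model: the
constantly-1 interpretation is a model, the pointwise infimum over all models
is a model, and it is the unique model lying pointwise below every model. -/
theorem minimal_fuzzy_model {A : Type*} (P : Set (Rule A)) (D : A → unitInterval) :
    IsModel P D (fun _ => 1) ∧
    IsModel P D (fun X => ⨅ I' : {J // IsModel P D J}, I'.1 X) ∧
    (∀ I', IsModel P D I' → ∀ X,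
        (⨅ I' : {J // IsModel P D J}, I'.1 X) ≤ I' X) ∧
    (∀ J, IsModel P D J → (∀ I', IsModel P D I' → ∀ X, J X ≤ I' X) →
        J = fun X => ⨅ I' : {J' // IsModel P D J'}, I'.1 X) :=
  ⟨isModel_one P D, isModel_iInf P D, fun _ hI => iInf_isModel_le hI, fun _ hJ hmin =>
    funext fun X => le_antisymm (le_iInf fun I' => hmin I'.1 I'.2 X) (iInf_isModel_le hJ X)⟩
end

section
/- Trigger truth degrees are non-increasing along a truth-greedy chase: let A be an arbitrary type of ground atoms, Π a set of ground rules over A, and D : A → [0,1] a fuzzy dataset. Let r₁, r₂, … be a (finite or infinite) sequence of rules of Π and I₀ = D, I₁, I₂, … interpretations such that each r_i is active in I_{i−1}, each I_i is the result of applying r_i to I_{i−1}, and the sequence is truth-greedy. Then for every index i ≥ 1 for which r_{i+1} is defined, the body fold of r_i under I_{i−1} is ≥ the body fold of r_{i+1} under I_i. -/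
/-- A rule is active in `I` if its body fold strictly exceeds the current
truth degree of its head. -/
def Rule.Active {A : Type*} (r : Rule A) (I : A → unitInterval) : Prop :=
  I r.head < r.bodyFold I

-- The result of applying rule `r` to `I`: the head atom gets the body fold
-- as its new truth degree; all other atoms are unchanged.
open Classical in
noncomputable def Rule.apply {A : Type*} (r : Rule A)
    (I : A → unitInterval) : A → unitInterval :=
  fun X => if X = r.head then r.bodyFold I else I X

theorem Tnorm.le_left (t : Tnorm) (a b : unitInterval) : t.toFun a b ≤ a := by
  have h := t.mono b 1 a unitInterval.le_one'
  rwa [t.comm b a, t.comm 1 a, t.one_identity] at h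

theorem Tnorm.le_right (t : Tnorm) (a b : unitInterval) : t.toFun a b ≤ b :=
  t.comm a b ▸ t.le_left b a

theorem Tnorm.foldr_le_of_mem (t : Tnorm) {l : List unitInterval} {a : unitInterval}
    (h : a ∈ l) : l.foldr t.toFun 1 ≤ a := by
  induction l with
  | nil => simp at h
  | cons b l ih =>
    rcases List.mem_cons.1 h with rfl | h
    · exact t.le_left _ _
    · exact (t.le_right _ _).trans (ih h)

theorem Rule.bodyFold_le_of_mem {A : Type*} (r : Rule A) (I : A → unitInterval) {X : A}
    (h : X ∈ r.body) : r.bodyFold I ≤ I X :=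
  r.tnorm.foldr_le_of_mem (List.mem_map_of_mem h)

theorem Rule.bodyFold_congr {A : Type*} (r : Rule A) {I J : A → unitInterval}
    (h : ∀ X ∈ r.body, I X = J X) : r.bodyFold I = r.bodyFold J := by
  unfold Rule.bodyFold
  rw [List.map_congr_left h]

theorem Rule.apply_head {A : Type*} (r : Rule A) (I : A → unitInterval) :
    r.apply I r.head = r.bodyFold I := by
  simp [Rule.apply]

theorem Rule.apply_of_ne {A : Type*} (r : Rule A) (I : A → unitInterval) {X : A}
    (h : X ≠ r.head) : r.apply I X = I X := by
  simp [Rule.apply, h]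

theorem Rule.Active.le_apply {A : Type*} {r : Rule A} {I : A → unitInterval}
    (h : r.Active I) : I ≤ r.apply I := by
  intro X
  by_cases hX : X = r.head
  · rw [hX, r.apply_head]
    exact h.le
  · rw [r.apply_of_ne I hX]

/-- Trigger truth degrees are non-increasing along a truth-greedy chase:
in a truth-greedy sequence of active-rule applications `I₀ = D, I₁, …, I_n`
with applied rules `r₁, …, r_n`, the body fold of `r i` under `I (i-1)` is at
least the body fold of `r (i+1)` under `I i`, for every `1 ≤ i` with
`i + 1 ≤ n`. -/
theorem truth_greedy_chase_degrees_antitone {A : Type*}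
    (P : Set (Rule A)) (D : A → unitInterval) (n : ℕ)
    (r : ℕ → Rule A) (I : ℕ → A → unitInterval)
    (h0 : I 0 = D)
    (hmem : ∀ i, 1 ≤ i → i ≤ n → r i ∈ P)
    (hact : ∀ i, 1 ≤ i → i ≤ n → (r i).Active (I (i - 1)))
    (happ : ∀ i, 1 ≤ i → i ≤ n → I i = (r i).apply (I (i - 1)))
    (hgreedy : ∀ i, 1 ≤ i → i ≤ n → ∀ s ∈ P, s.Active (I (i - 1)) →
        s.bodyFold (I (i - 1)) ≤ (r i).bodyFold (I (i - 1))) :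
    ∀ i, 1 ≤ i → i + 1 ≤ n →
      (r (i + 1)).bodyFold (I i) ≤ (r i).bodyFold (I (i - 1)) := by
  intro i hi hin
  have hi' : i ≤ n := by omega
  have hs := hact (i + 1) (by omega) hin
  rw [Nat.add_sub_cancel] at hs
  have hI := happ i hi hi'
  by_cases hb : (r i).head ∈ (r (i + 1)).body
  · calc (r (i + 1)).bodyFold (I i) ≤ I i (r i).head := Rule.bodyFold_le_of_mem _ _ hb
      _ = (r i).bodyFold (I (i - 1)) := by rw [hI, Rule.apply_head]
  · have hfold : (r (i + 1)).bodyFold (I i) = (r (i + 1)).bodyFold (I (i - 1)) := by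
      rw [hI]
      exact Rule.bodyFold_congr _ fun X hX =>
        Rule.apply_of_ne _ _ fun hX' => hb (hX' ▸ hX)
    have hle : I (i - 1) (r (i + 1)).head ≤ I i (r (i + 1)).head := by
      rw [hI]
      exact (hact i hi hi').le_apply _
    rw [hfold]
    exact hgreedy i hi hi' _ (hmem _ (by omega) hin) (hle.trans_lt (hs.trans_eq hfold))
end

section
/- A finite exhausted chase computes the minimal (universal) fuzzy model: let A be an arbitrary type of ground atoms, Π a set of ground rules over A, and D : A → [0,1] a fuzzy dataset. Suppose r₁, …, r_n is a finite sequence of rules of Π and I₀ = D, I₁, …, I_n are interpretations such that each r_i is active in I_{i−1}, each I_i is the result of applying r_i to I_{i−1}, and no rule of Π is active in I_n. Then I_n is a model of (Π, D), and I_n ≤ I' pointwise for every model I' of (Π, D). -/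
theorem Rule.bodyFold_mono_s10 {A : Type*} (r : Rule A) : Monotone r.bodyFold := by
  intro I J h
  unfold Rule.bodyFold
  induction r.body with
  | nil => exact le_rfl
  | cons X l ih => exact r.tnorm.toFun_le_toFun (h X) ih

theorem Rule.Sat.apply_le {A : Type*} {r : Rule A} {I J : A → unitInterval}
    (hJ : r.Sat J) (h : I ≤ J) : r.apply I ≤ J := by
  intro X
  unfold Rule.apply
  split_ifs with hX
  · exact hX ▸ (r.bodyFold_mono_s10 h).trans hJ
  · exact h X

/-- A finite exhausted chase computes the minimal (universal) fuzzy model: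
if `I₀ = D, I₁, …, I_n` is a sequence of active-rule applications and no rule
of `P` is active in `I n`, then `I n` is a model of `(P, D)` lying pointwise
below every model of `(P, D)`. -/
theorem exhausted_chase_minimal_model {A : Type*}
    (P : Set (Rule A)) (D : A → unitInterval) (n : ℕ)
    (r : ℕ → Rule A) (I : ℕ → A → unitInterval)
    (h0 : I 0 = D)
    (hmem : ∀ i, 1 ≤ i → i ≤ n → r i ∈ P)
    (hact : ∀ i, 1 ≤ i → i ≤ n → (r i).Active (I (i - 1)))
    (happ : ∀ i, 1 ≤ i → i ≤ n → I i = (r i).apply (I (i - 1)))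
    (hexh : ∀ s ∈ P, ¬ s.Active (I n)) :
    IsModel P D (I n) ∧
    ∀ I', IsModel P D I' → ∀ X, I n X ≤ I' X := by
  refine ⟨⟨fun s hs => not_lt.mp (hexh s hs), ?_⟩, fun I' hI' => ?_⟩
  · suffices h : ∀ i ≤ n, D ≤ I i from h n le_rfl
    intro i
    induction i with
    | zero => exact fun _ => h0.ge
    | succ k ih =>
      intro hk
      rw [happ (k + 1) (by lia) hk]
      exact (ih (by lia)).trans (hact (k + 1) (by lia) hk).le_apply
  · suffices h : ∀ i ≤ n, I i ≤ I' from h n le_rfl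
    intro i
    induction i with
    | zero => exact fun _ => h0.le.trans hI'.2
    | succ k ih =>
      intro hk
      rw [happ (k + 1) (by lia) hk]
      exact (hI'.1 _ (hmem (k + 1) (by lia) hk)).apply_le (ih (by lia))
end
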